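/- Consider the (rVS-SQN) scheme under the stated assumptions, with (μ_k) a positive nonincreasing sequence and stepsizes satisfying γ_k ≤ λ̲/(λ̄_k²(L + μ_0)) for all k ≥ 0. Then for every k, almost surely, E[f_{μ_{k+1}}(x_{k+1}) | 𝓕_k] − f* ≤ (1 − λ̲ μ_k γ_k)·(f_{μ_k}(x_k) − f*) + (λ̲·dist²(x_0, X*)/2)·μ_k² γ_k + ((L + μ_k)·λ̄_k²·(ν₁²‖x_k‖² + ν₂²)/(2 N_k))·γ_k². -/

import Mathlib

open MeasureTheory Filter
open scoped RealInnerProductSpace Topology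

noncomputable section

section Symmetric

variable {E : Type*} [NormedAddCommGroup E] [InnerProductSpace ℝ E]

theorem LinearMap.IsSymmetric.norm_sq_le_mul_inner {T : E →ₗ[ℝ] E} (hT : T.IsSymmetric) {C : ℝ}
    (hC : 0 < C) (hpos : ∀ v, 0 ≤ ⟪T v, v⟫) (hle : ∀ v, ⟪T v, v⟫ ≤ C * ‖v‖ ^ 2) (v : E) :
    ‖T v‖ ^ 2 ≤ C * ⟪T v, v⟫ := by
  have h1 := hpos (C • v - T v)
  have h2 := hle (T v)
  have h3 : ⟪T (T v), v⟫ = ‖T v‖ ^ 2 := by rw [hT (T v) v, real_inner_self_eq_norm_sq]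
  simp only [map_sub, map_smul, inner_sub_left, inner_sub_right, real_inner_smul_left,
    real_inner_smul_right, h3, real_inner_self_eq_norm_sq] at h1
  refine le_of_mul_le_mul_left ?_ hC
  linarith

theorem LinearMap.IsSymmetric.norm_le_mul_norm {T : E →ₗ[ℝ] E} (hT : T.IsSymmetric) {C : ℝ}
    (hC : 0 < C) (hpos : ∀ v, 0 ≤ ⟪T v, v⟫) (hle : ∀ v, ⟪T v, v⟫ ≤ C * ‖v‖ ^ 2) (v : E) :
    ‖T v‖ ≤ C * ‖v‖ := by
  refine abs_le_of_sq_le_sq' ?_ (by positivity) |>.2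
  nlinarith [hT.norm_sq_le_mul_inner hC hpos hle v, hle v]

end Symmetric

section Smooth

variable {E : Type*} [NormedAddCommGroup E] [InnerProductSpace ℝ E] [CompleteSpace E]
  {f : E → ℝ} {gf : E → E}

theorem HasGradientAt.hasDerivAt_comp_add_smul {g x d : E} {t : ℝ}
    (h : HasGradientAt f g (x + t • d)) :
    HasDerivAt (fun s : ℝ => f (x + s • d)) ⟪g, d⟫ t := by
  have hline : HasDerivAt (fun s : ℝ => x + s • d) d t := by
    simpa using ((hasDerivAt_id t).smul_const d).const_add x
  simpa [Function.comp_def] using h.hasFDerivAt.comp_hasDerivAt t hline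

theorem ConvexOn.add_inner_gradient_le (hf : ConvexOn ℝ Set.univ f) {g x : E}
    (h : HasGradientAt f g x) (z : E) : f x + ⟪g, z - x⟫ ≤ f z := by
  have hconv : ConvexOn ℝ Set.univ (fun s : ℝ => f (x + s • (z - x))) := by
    have := hf.comp_affineMap (AffineMap.lineMap x z)
    simpa [Function.comp_def, AffineMap.lineMap_apply, add_comm] using this
  have hd : HasDerivAt (fun s : ℝ => f (x + s • (z - x))) ⟪g, z - x⟫ 0 :=
    HasGradientAt.hasDerivAt_comp_add_smul (by simpa using h)
  have := hconv.le_slope_of_hasDerivAt (Set.mem_univ 0) (Set.mem_univ 1) one_pos hd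
  simp [slope] at this
  linarith

theorem le_add_inner_gradient_add_sq {L : ℝ} (hgrad : ∀ z, HasGradientAt f (gf z) z)
    (hlip : ∀ z z', ‖gf z - gf z'‖ ≤ L * ‖z - z'‖) (x d : E) :
    f (x + d) ≤ f x + ⟪gf x, d⟫ + L / 2 * ‖d‖ ^ 2 := by
  have hd (t : ℝ) : HasDerivAt
      (fun s : ℝ => f (x + s • d) - (s * ⟪gf x, d⟫ + L / 2 * ‖d‖ ^ 2 * s ^ 2))
      (⟪gf (x + t • d), d⟫ - (⟪gf x, d⟫ + L / 2 * ‖d‖ ^ 2 * (2 * t))) t := by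
    refine (hgrad _).hasDerivAt_comp_add_smul.sub (.add ?_ ?_)
    · simpa using (hasDerivAt_id t).mul_const ⟪gf x, d⟫
    · simpa using (hasDerivAt_pow 2 t).const_mul (L / 2 * ‖d‖ ^ 2)
  have hanti : AntitoneOn
      (fun s : ℝ => f (x + s • d) - (s * ⟪gf x, d⟫ + L / 2 * ‖d‖ ^ 2 * s ^ 2))
      (Set.Icc 0 1) := by
    refine antitoneOn_of_deriv_nonpos (convex_Icc 0 1)
      (fun t _ => (hd t).continuousAt.continuousWithinAt)
      (fun t _ => (hd t).differentiableAt.differentiableWithinAt) fun t ht => ?_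
    rw [interior_Icc] at ht
    rw [(hd t).deriv]
    have h1 : ⟪gf (x + t • d) - gf x, d⟫ ≤ L * (t * ‖d‖) * ‖d‖ := by
      refine (real_inner_le_norm _ _).trans ?_
      gcongr
      refine (hlip _ _).trans_eq ?_
      rw [add_sub_cancel_left, norm_smul, Real.norm_of_nonneg ht.1.le]
    rw [inner_sub_left] at h1
    linarith
  have := hanti (Set.left_mem_Icc.2 zero_le_one) (Set.right_mem_Icc.2 zero_le_one) zero_le_one
  simp at this
  linarith

theorem regularized_gap_le_norm_sq {g x z : E} {μ : ℝ} (hμ : 0 < μ)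
    (hf : ConvexOn ℝ Set.univ f) (h : HasGradientAt f g x) (x0 : E) :
    2 * μ * (f x + μ / 2 * ‖x - x0‖ ^ 2 - f z) - μ ^ 2 * ‖x0 - z‖ ^ 2
      ≤ ‖g + μ • (x - x0)‖ ^ 2 := by
  have h1 := hf.add_inner_gradient_le h z
  have h2 : 0 ≤ ‖(g + μ • (x - x0)) + μ • (z - x)‖ ^ 2 := by positivity
  have h3 : ‖x0 - z‖ ^ 2 = ‖x - x0‖ ^ 2 + 2 * ⟪x - x0, z - x⟫ + ‖z - x‖ ^ 2 := by
    rw [← norm_add_sq_real, norm_sub_rev]; congr 2; abel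
  rw [norm_add_sq_real, real_inner_smul_right, inner_add_left, real_inner_smul_left, norm_smul,
    Real.norm_of_nonneg hμ.le] at h2
  rw [h3]
  nlinarith [mul_le_mul_of_nonneg_left h1 hμ.le]

theorem regularized_step_le {L μ μ' γ l u : ℝ} (hL : 0 < L) (hμ : 0 < μ) (hμ' : μ' ≤ μ)
    (hγ : 0 < γ) (hl : 0 < l) (hlu : l ≤ u) (hγle : γ * (u ^ 2 * (L + μ)) ≤ l)
    (hconv : ConvexOn ℝ Set.univ f) (hgrad : ∀ z, HasGradientAt f (gf z) z)
    (hlip : ∀ z z', ‖gf z - gf z'‖ ≤ L * ‖z - z'‖)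
    {T : E →ₗ[ℝ] E} (hT : T.IsSymmetric) (hlow : ∀ v, l * ‖v‖ ^ 2 ≤ ⟪T v, v⟫)
    (hup : ∀ v, ⟪T v, v⟫ ≤ u * ‖v‖ ^ 2) {x x0 z w g : E} (hg : g = gf x + μ • (x - x0)) :
    f (x - γ • T (g + w)) + μ' / 2 * ‖x - γ • T (g + w) - x0‖ ^ 2
      ≤ f z + (1 - l * μ * γ) * (f x + μ / 2 * ‖x - x0‖ ^ 2 - f z)
        + l * ‖x0 - z‖ ^ 2 / 2 * μ ^ 2 * γ
        + ⟪((L + μ) * γ ^ 2) • T (T g) - γ • T g, w⟫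
        + (L + μ) / 2 * γ ^ 2 * u ^ 2 * ‖w‖ ^ 2 := by
  have hu : 0 < u := hl.trans_le hlu
  have hpos (v : E) : 0 ≤ ⟪T v, v⟫ := le_trans (by positivity) (hlow v)
  have hTg := hT.norm_sq_le_mul_inner hu hpos hup g
  have hTw : ‖T w‖ ^ 2 ≤ u ^ 2 * ‖w‖ ^ 2 := by
    rw [← mul_pow]; gcongr; exact hT.norm_le_mul_norm hu hpos hup w
  have hgap := regularized_gap_le_norm_sq (z := z) hμ hconv (hgrad x) x0
  rw [← hg] at hgap
  have hdesc := le_add_inner_gradient_add_sq hgrad hlip x (-(γ • T (g + w)))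
  have hquad : ‖x - γ • T (g + w) - x0‖ ^ 2
      = ‖x - x0‖ ^ 2 + 2 * ⟪x - x0, -(γ • T (g + w))⟫ + ‖-(γ • T (g + w))‖ ^ 2 := by
    rw [← norm_add_sq_real]; congr 2; abel
  have hinner : ⟪gf x, -(γ • T (g + w))⟫ + μ * ⟪x - x0, -(γ • T (g + w))⟫
      = - γ * (⟪T g, g⟫ + ⟪T g, w⟫) := by
    rw [← real_inner_smul_left, ← inner_add_left, ← hg, inner_neg_right, real_inner_smul_right,
      ← hT, inner_add_right]
    ring
  have hnorm : ‖-(γ • T (g + w))‖ ^ 2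
      = γ ^ 2 * (‖T g‖ ^ 2 + 2 * ⟪T (T g), w⟫ + ‖T w‖ ^ 2) := by
    rw [norm_neg, norm_smul, mul_pow, Real.norm_of_nonneg hγ.le, map_add, norm_add_sq_real,
      hT (T g) w]
  have hreg : μ' / 2 * ‖x - γ • T (g + w) - x0‖ ^ 2 ≤ μ / 2 * ‖x - γ • T (g + w) - x0‖ ^ 2 := by
    gcongr
  have hγu : γ * (L + μ) * u ≤ 1 := by
    refine le_of_mul_le_mul_left ?_ hu
    linarith
  have hTg' : (L + μ) / 2 * γ ^ 2 * ‖T g‖ ^ 2 ≤ γ / 2 * ⟪T g, g⟫ := by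
    calc (L + μ) / 2 * γ ^ 2 * ‖T g‖ ^ 2 ≤ (L + μ) / 2 * γ ^ 2 * (u * ⟪T g, g⟫) := by gcongr
      _ = (γ / 2 * ⟪T g, g⟫) * (γ * (L + μ) * u) := by ring
      _ ≤ (γ / 2 * ⟪T g, g⟫) * 1 := by
        have := hpos g
        gcongr
      _ = _ := mul_one _
  have hTw' : (L + μ) / 2 * γ ^ 2 * ‖T w‖ ^ 2 ≤ (L + μ) / 2 * γ ^ 2 * (u ^ 2 * ‖w‖ ^ 2) := by
    gcongr
  have hlow' : γ / 2 * (l * (2 * μ * (f x + μ / 2 * ‖x - x0‖ ^ 2 - f z) - μ ^ 2 * ‖x0 - z‖ ^ 2))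
      ≤ γ / 2 * ⟪T g, g⟫ := by
    gcongr
    exact le_trans (by gcongr) (hlow g)
  rw [← sub_eq_add_neg] at hdesc
  rw [inner_sub_left, real_inner_smul_left, real_inner_smul_left]
  rw [hnorm] at hdesc hquad
  rw [hquad] at hreg ⊢
  linarith

end Smooth

section Matrix

variable {n : ℕ} {Ω : Type*}

theorem measurable_toEuclideanLin_apply {m : MeasurableSpace Ω}
    {H : Ω → Matrix (Fin n) (Fin n) ℝ} (hH : ∀ i j, Measurable fun ω => H ω i j)
    {v : Ω → EuclideanSpace ℝ (Fin n)} (hv : Measurable v) :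
    Measurable fun ω => Matrix.toEuclideanLin (H ω) (v ω) := by
  have h (j : Fin n) : Measurable fun ω => v ω j := by fun_prop
  refine (MeasurableEquiv.toLp 2 (Fin n → ℝ)).measurable.comp
    (measurable_pi_lambda _ fun i => ?_)
  change Measurable fun ω => ∑ j, H ω i j * v ω j
  exact Finset.measurable_fun_sum _ fun j _ => (hH i j).mul (h j)

theorem measurable_matrix_adjugate_apply {m : MeasurableSpace Ω}
    {H : Ω → Matrix (Fin n) (Fin n) ℝ} (hH : ∀ i j, Measurable fun ω => H ω i j) (i j : Fin n) :
    Measurable fun ω => (H ω).adjugate i j := by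
  have h : Measurable fun ω => (fun i j => H ω i j : Fin n → Fin n → ℝ) :=
    measurable_pi_lambda _ fun i => measurable_pi_lambda _ fun j => hH i j
  have hc : Continuous fun A : Fin n → Fin n → ℝ => (Matrix.of A).adjugate i j :=
    (Continuous.matrix_adjugate (A := fun A : Fin n → Fin n → ℝ => Matrix.of A)
      continuous_id).matrix_elem i j
  exact hc.measurable.comp h

theorem measurable_matrix_det {m : MeasurableSpace Ω}
    {H : Ω → Matrix (Fin n) (Fin n) ℝ} (hH : ∀ i j, Measurable fun ω => H ω i j) :
    Measurable fun ω => (H ω).det := by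
  have h : Measurable fun ω => (fun i j => H ω i j : Fin n → Fin n → ℝ) :=
    measurable_pi_lambda _ fun i => measurable_pi_lambda _ fun j => hH i j
  have hc : Continuous fun A : Fin n → Fin n → ℝ => (Matrix.of A).det :=
    Continuous.matrix_det (A := fun A : Fin n → Fin n → ℝ => Matrix.of A) continuous_id
  exact hc.measurable.comp h

theorem measurable_matrix_inv_apply {m : MeasurableSpace Ω}
    {H : Ω → Matrix (Fin n) (Fin n) ℝ} (hH : ∀ i j, Measurable fun ω => H ω i j) (i j : Fin n) :
    Measurable fun ω => (H ω)⁻¹ i j := by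
  simp only [Matrix.inv_def, Matrix.smul_apply, Ring.inverse_eq_inv', smul_eq_mul]
  exact (measurable_matrix_det hH).inv.mul (measurable_matrix_adjugate_apply hH i j)

theorem toEuclideanLin_inv_apply_of_coercive {A : Matrix (Fin n) (Fin n) ℝ} {l : ℝ} (hl : 0 < l)
    (hA : ∀ v : EuclideanSpace ℝ (Fin n), l * ‖v‖ ^ 2 ≤ ⟪Matrix.toEuclideanLin A v, v⟫)
    (v : EuclideanSpace ℝ (Fin n)) :
    Matrix.toEuclideanLin A⁻¹ (Matrix.toEuclideanLin A v) = v := by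
  have hu : IsUnit A := by
    rw [← Matrix.mulVec_injective_iff_isUnit]
    refine (injective_iff_map_eq_zero A.mulVecLin).2 fun u hu => ?_
    have h := hA (WithLp.toLp 2 u)
    rw [Matrix.toLpLin_toLp, Matrix.toLin'_apply, ← Matrix.mulVecLin_apply, hu] at h
    simp only [WithLp.toLp_zero, inner_zero_left] at h
    have h0 : ‖WithLp.toLp 2 u‖ = 0 := by
      by_contra hne
      have : 0 < ‖WithLp.toLp 2 u‖ := lt_of_le_of_ne (norm_nonneg _) (Ne.symm hne)
      have : 0 < l * ‖WithLp.toLp 2 u‖ ^ 2 := by positivity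
      linarith
    simpa using h0
  rw [Matrix.isUnit_iff_isUnit_det] at hu
  simp [Matrix.toLpLin_apply, Matrix.mulVec_mulVec, Matrix.nonsing_inv_mul A hu]

theorem mul_norm_le_norm_of_coercive {E : Type*} [NormedAddCommGroup E] [InnerProductSpace ℝ E]
    {T : E → E} {l : ℝ} (hT : ∀ v, l * ‖v‖ ^ 2 ≤ ⟪T v, v⟫) (v : E) : l * ‖v‖ ≤ ‖T v‖ := by
  rcases (norm_nonneg v).eq_or_lt with h | h
  · simp [← h]
  · refine le_of_mul_le_mul_right ?_ h
    linarith [hT v, real_inner_le_norm (T v) v]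

end Matrix

section CondExp

variable {Ω E : Type*} {m m0 : MeasurableSpace Ω} {P : Measure Ω} [NormedAddCommGroup E]
  [InnerProductSpace ℝ E]

theorem MeasureTheory.MemLp.integrable_real_inner {v w : Ω → E} (hv : MemLp v 2 P)
    (hw : MemLp w 2 P) : Integrable (fun ω => ⟪v ω, w ω⟫) P := by
  refine (hv.norm.integrable_mul hw.norm).mono (hv.1.inner hw.1) (ae_of_all _ fun ω => ?_)
  simpa using norm_inner_le_norm (𝕜 := ℝ) (v ω) (w ω)

theorem condExp_le_of_le_add_inner_add_sq [CompleteSpace E] [IsFiniteMeasure P] (hm : m ≤ m0)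
    {Y A : Ω → ℝ} {v w : Ω → E} {c : ℝ} (hY : Integrable Y P)
    (hA : StronglyMeasurable[m] A) (hA_int : Integrable A P)
    (hv : StronglyMeasurable[m] v) (hv_mem : MemLp v 2 P) (hw_mem : MemLp w 2 P)
    (hw : P[w | m] =ᵐ[P] 0)
    (hle : ∀ᵐ ω ∂P, Y ω ≤ A ω + ⟪v ω, w ω⟫ + c * ‖w ω‖ ^ 2) :
    ∀ᵐ ω ∂P, (P[Y | m]) ω ≤ A ω + c * (P[fun ω' => ‖w ω'‖ ^ 2 | m]) ω := by
  have hvw : Integrable (fun ω => ⟪v ω, w ω⟫) P := hv_mem.integrable_real_inner hw_mem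
  have hww : Integrable (fun ω => ‖w ω‖ ^ 2) P := hw_mem.integrable_norm_pow (by norm_num)
  have h1 := condExp_mono (m := m) hY ((hA_int.add hvw).add (hww.smul c)) hle
  have h2 := condExp_add (hA_int.add hvw) (hww.smul c) m
  have h3 := condExp_add hA_int hvw m
  have h4 := condExp_smul (μ := P) c (fun ω => ‖w ω‖ ^ 2) m
  have h5 : P[fun ω => ⟪v ω, w ω⟫ | m] =ᵐ[P] fun ω => ⟪v ω, (P[w | m]) ω⟫ :=
    condExp_bilin_of_stronglyMeasurable_left (innerSL ℝ) hv hvw (hw_mem.integrable one_le_two)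
  have h6 := condExp_of_stronglyMeasurable hm hA hA_int
  filter_upwards [h1, h2, h3, h4, h5, hw] with ω h1 h2 h3 h4 h5 hw
  rw [hw, Pi.zero_apply, inner_zero_right] at h5
  simp only [Pi.add_apply, Pi.smul_apply, smul_eq_mul] at h2 h3 h4
  rw [h2, h3, h4, h5, h6] at h1
  linarith

end CondExp

/-- One-step error bound (in conditional expectation) for the
(rVS-SQN) scheme on a merely convex `L`-smooth function. -/
theorem rvs_sqn_error_bound
    {n : ℕ} {Ω : Type*} {m0 : MeasurableSpace Ω} (P : Measure Ω) [IsProbabilityMeasure P]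
    (ℱ : Filtration ℕ m0)
    (f : EuclideanSpace ℝ (Fin n) → ℝ) (gf : EuclideanSpace ℝ (Fin n) → EuclideanSpace ℝ (Fin n))
    (L ν₁ ν₂ llam fstar : ℝ)
    (hL : 0 < L) (hν₁ : 0 < ν₁) (hν₂ : 0 < ν₂) (hllam : 0 < llam)
    (hconv : ConvexOn ℝ Set.univ f)
    (hgrad : ∀ z, HasGradientAt f (gf z) z)
    (hlip : ∀ z z', ‖gf z - gf z'‖ ≤ L * ‖z - z'‖)
    (Xstar : Set (EuclideanSpace ℝ (Fin n)))
    (hXstar : Xstar = {z | ∀ x, f z ≤ f x}) (hXne : Xstar.Nonempty)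
    (xmin : EuclideanSpace ℝ (Fin n)) (hxmin : xmin ∈ Xstar) (hfstar : fstar = f xmin)
    (x0 : EuclideanSpace ℝ (Fin n))
    (μreg γ : ℕ → ℝ) (ulam : ℕ → ℝ) (N : ℕ → ℕ)
    (hμpos : ∀ k, 0 < μreg k) (hμmono : Antitone μreg)
    (hulam : ∀ k, llam ≤ ulam k)
    (hγpos : ∀ k, 0 < γ k)
    (hγle : ∀ k, γ k ≤ llam / (ulam k ^ 2 * (L + μreg 0)))
    (hNpos : ∀ k, 0 < N k)
    (x w : ℕ → Ω → EuclideanSpace ℝ (Fin n))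
    (H : ℕ → Ω → Matrix (Fin n) (Fin n) ℝ)
    (hx_meas : ∀ k, Measurable[ℱ k] (x k))
    (hf_int : ∀ k, Integrable (fun ω => f (x k ω)) P)
    (hx0_int : ∀ k, Integrable (fun ω => ‖x k ω - x0‖ ^ 2) P)
    (hH_meas : ∀ k, ∀ i j, Measurable[ℱ k] fun ω => H k ω i j)
    (hH_symm : ∀ k, ∀ᵐ ω ∂P, (H k ω).IsSymm)
    (hH_bnd : ∀ k, ∀ᵐ ω ∂P, ∀ v : EuclideanSpace ℝ (Fin n),
      llam * ‖v‖ ^ 2 ≤ ⟪(Matrix.toEuclideanLin (H k ω)) v, v⟫ ∧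
      ⟪(Matrix.toEuclideanLin (H k ω)) v, v⟫ ≤ ulam k * ‖v‖ ^ 2)
    (hw_mean : ∀ k, P[w k | ℱ k] =ᵐ[P] 0)
    (hw_var : ∀ k, ∀ᵐ ω ∂P,
      (P[fun ω' => ‖w k ω'‖ ^ 2 | ℱ k]) ω ≤ (ν₁ ^ 2 * ‖x k ω‖ ^ 2 + ν₂ ^ 2) / (N k))
    (hupdate : ∀ k ω, x (k + 1) ω
      = x k ω - γ k • (Matrix.toEuclideanLin (H k ω))
          (gf (x k ω) + μreg k • (x k ω - x0) + w k ω)) :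
    ∀ k, ∀ᵐ ω ∂P,
      (P[fun ω' => f (x (k + 1) ω') + (μreg (k + 1) / 2) * ‖x (k + 1) ω' - x0‖ ^ 2
          | ℱ k]) ω - fstar
        ≤ (1 - llam * μreg k * γ k)
            * (f (x k ω) + (μreg k / 2) * ‖x k ω - x0‖ ^ 2 - fstar)
          + (llam * Metric.infDist x0 Xstar ^ 2 / 2) * μreg k ^ 2 * γ k
          + ((L + μreg k) * ulam k ^ 2 * (ν₁ ^ 2 * ‖x k ω‖ ^ 2 + ν₂ ^ 2) / (2 * N k))
              * γ k ^ 2 := by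
  intro k
  have hm : ℱ k ≤ m0 := ℱ.le k
  have hu : 0 < ulam k := hllam.trans_le (hulam k)
  have hμk := hμpos k
  have hγk := hγpos k
  have hμ0 : μreg k ≤ μreg 0 := hμmono (Nat.zero_le k)
  have hstep : γ k * (ulam k ^ 2 * (L + μreg k)) ≤ llam := by
    calc γ k * (ulam k ^ 2 * (L + μreg k)) ≤ γ k * (ulam k ^ 2 * (L + μreg 0)) := by gcongr
      _ ≤ llam := (le_div_iff₀ (by have := hμpos 0; positivity)).1 (hγle k)
  have hcont_f : Continuous f :=
    continuous_iff_continuousAt.2 fun z => (hgrad z).hasFDerivAt.continuousAt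
  have hcont_gf : Continuous gf :=
    (LipschitzWith.of_dist_le_mul (K := L.toNNReal) fun z z' => by
      simpa [dist_eq_norm, hL.le] using hlip z z').continuous
  have hclosed : IsClosed Xstar := by
    rw [hXstar, Set.ofPred_forall]
    exact isClosed_iInter fun y => isClosed_le hcont_f continuous_const
  obtain ⟨z, hz, hdist⟩ := hclosed.exists_infDist_eq_dist hXne x0
  have hfz : f z = fstar := by
    rw [hXstar] at hz hxmin
    rw [hfstar]
    exact le_antisymm (hz xmin) (hxmin z)
  have hT : ∀ᵐ ω ∂P, (Matrix.toEuclideanLin (H k ω)).IsSymmetric := by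
    filter_upwards [hH_symm k] with ω hω
    rw [Matrix.isSymmetric_toEuclideanLin_iff]
    exact (Matrix.conjTranspose_eq_transpose_of_trivial _).trans hω
  have hx_m0 (j : ℕ) : Measurable (x j) := (hx_meas j).mono (ℱ.le j) le_rfl
  have hx_mem (j : ℕ) : MemLp (fun ω => x j ω - x0) 2 P :=
    (memLp_two_iff_integrable_sq_norm
      ((hx_m0 j).sub_const x0).aestronglyMeasurable).2 (hx0_int j)
  set g : Ω → EuclideanSpace ℝ (Fin n) := fun ω => gf (x k ω) + μreg k • (x k ω - x0) with hg
  have hg_meas : Measurable[ℱ k] g :=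
    (hcont_gf.measurable.comp (hx_meas k)).add (((hx_meas k).sub_const x0).const_smul (μreg k))
  have hg_mem : MemLp g 2 P := by
    have h1 : MemLp (fun ω => gf (x k ω) - gf x0) 2 P :=
      (hx_mem k).of_le_mul
        ((hcont_gf.measurable.comp (hx_m0 k)).sub_const _).aestronglyMeasurable
        (ae_of_all _ fun ω => hlip _ _)
    have h2 := (h1.add (memLp_const (gf x0))).add ((hx_mem k).const_smul (μreg k))
    refine h2.ae_eq (ae_of_all _ fun ω => ?_)
    simp [hg]
  have hH_lip : ∀ᵐ ω ∂P, ∀ v, ‖Matrix.toEuclideanLin (H k ω) v‖ ≤ ulam k * ‖v‖ := by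
    filter_upwards [hT, hH_bnd k] with ω hTω hω v
    exact hTω.norm_le_mul_norm hu (fun u => le_trans (by positivity) (hω u).1)
      (fun u => (hω u).2) v
  have hH_memLp {v : Ω → EuclideanSpace ℝ (Fin n)} (hv : Measurable[ℱ k] v)
      (hv_mem : MemLp v 2 P) :
      MemLp (fun ω => Matrix.toEuclideanLin (H k ω) (v ω)) 2 P := by
    refine hv_mem.of_le_mul (c := ulam k)
      ((measurable_toEuclideanLin_apply (hH_meas k) hv).mono hm le_rfl).aestronglyMeasurable ?_
    filter_upwards [hH_lip] with ω hω using hω _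
  have hstep_eq (ω : Ω) : Matrix.toEuclideanLin (H k ω) (g ω + w k ω)
      = (γ k)⁻¹ • (x k ω - x (k + 1) ω) := by
    rw [hupdate k ω, sub_sub_cancel, inv_smul_smul₀ hγk.ne']
  have hgw_mem : MemLp (fun ω => g ω + w k ω) 2 P := by
    have hdiff : MemLp (fun ω => x k ω - x (k + 1) ω) 2 P := by
      refine ((hx_mem k).sub (hx_mem (k + 1))).ae_eq (ae_of_all _ fun ω => ?_)
      simp
    have hmeas : AEStronglyMeasurable (fun ω => g ω + w k ω) P := by
      have h : Measurable fun ω =>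
          Matrix.toEuclideanLin (H k ω)⁻¹ ((γ k)⁻¹ • (x k ω - x (k + 1) ω)) :=
        measurable_toEuclideanLin_apply
          (measurable_matrix_inv_apply fun i j => (hH_meas k i j).mono hm le_rfl)
          (((hx_m0 k).sub (hx_m0 (k + 1))).const_smul (γ k)⁻¹)
      refine h.aestronglyMeasurable.congr ?_
      filter_upwards [hH_bnd k] with ω hω
      rw [← hstep_eq ω]
      exact toEuclideanLin_inv_apply_of_coercive hllam (fun v => (hω v).1) _
    refine hdiff.of_le_mul (c := llam⁻¹ * (γ k)⁻¹) hmeas ?_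
    filter_upwards [hH_bnd k] with ω hω
    have h := mul_norm_le_norm_of_coercive (fun v => (hω v).1) (g ω + w k ω)
    rw [hstep_eq ω, norm_smul, norm_inv, Real.norm_of_nonneg hγk.le] at h
    rw [mul_assoc]
    exact (le_inv_mul_iff₀ hllam).2 h
  have hw_mem : MemLp (w k) 2 P := by
    refine (hgw_mem.sub hg_mem).ae_eq (ae_of_all _ fun ω => ?_)
    simp
  have hHg_meas := measurable_toEuclideanLin_apply (hH_meas k) hg_meas
  have hHg_mem := hH_memLp hg_meas hg_mem
  have hHHg_meas := measurable_toEuclideanLin_apply (hH_meas k) hHg_meas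
  have hHHg_mem := hH_memLp hHg_meas hHg_mem
  have hF_int (j : ℕ) (c : ℝ) : Integrable (fun ω => f (x j ω) + c * ‖x j ω - x0‖ ^ 2) P :=
    (hf_int j).add ((hx0_int j).const_mul c)
  have hF_meas : Measurable[ℱ k]
      (fun ω => f (x k ω) + μreg k / 2 * ‖x k ω - x0‖ ^ 2) :=
    (show Continuous fun y => f y + μreg k / 2 * ‖y - x0‖ ^ 2 by fun_prop).measurable.comp
      (hx_meas k)
  set A : Ω → ℝ := fun ω => f z
    + (1 - llam * μreg k * γ k) * (f (x k ω) + μreg k / 2 * ‖x k ω - x0‖ ^ 2 - f z)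
    + llam * ‖x0 - z‖ ^ 2 / 2 * μreg k ^ 2 * γ k with hA
  have hA_meas : Measurable[ℱ k] A :=
    Measurable.add_const (Measurable.const_add
      (Measurable.const_mul (Measurable.sub_const hF_meas _) _) _) _
  have hA_int : Integrable A P :=
    ((integrable_const _).add (((hF_int k _).sub (integrable_const _)).const_mul _)).add
      (integrable_const _)
  set v : Ω → EuclideanSpace ℝ (Fin n) := fun ω => ((L + μreg k) * γ k ^ 2) •
      Matrix.toEuclideanLin (H k ω) (Matrix.toEuclideanLin (H k ω) (g ω))
    - γ k • Matrix.toEuclideanLin (H k ω) (g ω)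
  have hv_meas : Measurable[ℱ k] v :=
    (hHHg_meas.const_smul ((L + μreg k) * γ k ^ 2)).sub (hHg_meas.const_smul (γ k))
  have hv_mem : MemLp v 2 P :=
    (hHHg_mem.const_smul ((L + μreg k) * γ k ^ 2)).sub (hHg_mem.const_smul (γ k))
  have hle : ∀ᵐ ω ∂P,
      f (x (k + 1) ω) + μreg (k + 1) / 2 * ‖x (k + 1) ω - x0‖ ^ 2
        ≤ A ω + ⟪v ω, w k ω⟫ + (L + μreg k) / 2 * γ k ^ 2 * ulam k ^ 2 * ‖w k ω‖ ^ 2 := by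
    filter_upwards [hT, hH_bnd k] with ω hTω hω
    rw [hupdate k ω]
    exact regularized_step_le hL hμk (hμmono k.le_succ) hγk hllam (hulam k) hstep hconv hgrad
      hlip hTω (fun v => (hω v).1) (fun v => (hω v).2) rfl
  have hcond := condExp_le_of_le_add_inner_add_sq hm (hF_int (k + 1) (μreg (k + 1) / 2))
    hA_meas.stronglyMeasurable hA_int hv_meas.stronglyMeasurable hv_mem hw_mem (hw_mean k) hle
  filter_upwards [hcond, hw_var k] with ω h1 h2
  rw [dist_eq_norm] at hdist
  have h3 : (L + μreg k) / 2 * γ k ^ 2 * ulam k ^ 2 * (P[fun ω' => ‖w k ω'‖ ^ 2 | ℱ k]) ω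
      ≤ (L + μreg k) * ulam k ^ 2 * (ν₁ ^ 2 * ‖x k ω‖ ^ 2 + ν₂ ^ 2) / (2 * N k) * γ k ^ 2 := by
    calc _ ≤ (L + μreg k) / 2 * γ k ^ 2 * ulam k ^ 2
          * ((ν₁ ^ 2 * ‖x k ω‖ ^ 2 + ν₂ ^ 2) / N k) := by gcongr
      _ = _ := by
        have : (N k : ℝ) ≠ 0 := by exact_mod_cast (hNpos k).ne'
        field_simp
  simp only [hA, hfz] at h1
  rw [hdist]
  linarith
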